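/- For every m ≥ 1, the total number of Schröder paths (of arbitrary semilength n ≥ 1) with exactly n−m diagonal steps in which every diagonal step is immediately followed by a horizontal step except if it is the last step, equals 2^(m+1)·C(m); that is, Σ_{n≥1} |RP(n,m)| = 2^(m+1)·C(m). -/

import Mathlib

/-! Schröder paths -/

inductive SStep : Type
  | H | V | D
deriving DecidableEq

def SStep.dx : SStep → ℕ
  | .H => 1 | .V => 0 | .D => 1

def SStep.dy : SStep → ℕ
  | .H => 0 | .V => 1 | .D => 1

def pathX (p : List SStep) : ℕ := (p.map SStep.dx).sum
def pathY (p : List SStep) : ℕ := (p.map SStep.dy).sum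

/-- A Schröder path of semilength `n`: from (0,0) to (n,n), steps H,V,D,
never rising above the diagonal. -/
def IsSchroder (n : ℕ) (p : List SStep) : Prop :=
  pathX p = n ∧ pathY p = n ∧ ∀ q : List SStep, q <+: p → pathY q ≤ pathX q

/-- No diagonal step starts on the diagonal. -/
def DiagFree (p : List SStep) : Prop :=
  ∀ q r : List SStep, p = q ++ SStep.D :: r → pathX q ≠ pathY q

/-- Every diagonal step is immediately followed by a horizontal step,
except if it is the last step. -/
def DFollowedByH (p : List SStep) : Prop :=
  ∀ q r : List SStep, p = q ++ SStep.D :: r → r = [] ∨ ∃ r' : List SStep, r = SStep.H :: r'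

def SP (n m : ℕ) : Type := {p : List SStep // IsSchroder n p ∧ p.count SStep.D + m = n}
def SPplus (n m : ℕ) : Type :=
  {p : List SStep // IsSchroder n p ∧ p.count SStep.D + m = n ∧ DiagFree p}
def SPzero (n m : ℕ) : Type :=
  {p : List SStep // IsSchroder n p ∧ p.count SStep.D + m = n ∧ ¬ DiagFree p}
def RP (n m : ℕ) : Type :=
  {p : List SStep // IsSchroder n p ∧ p.count SStep.D + m = n ∧ DFollowedByH p}

/-! Rooted planar trees -/

inductive PTree : Type
  | node : List PTree → PTree

namespace PTree

def leaves : PTree → ℕ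
  | node [] => 1
  | node (c :: cs) => ((c :: cs).attach.map fun x => leaves x.1).sum
decreasing_by
  have := List.sizeOf_lt_of_mem x.2
  simp only [PTree.node.sizeOf_spec, List.cons.sizeOf_spec] at this ⊢
  omega

def internal : PTree → ℕ
  | node [] => 0
  | node (c :: cs) => 1 + ((c :: cs).attach.map fun x => internal x.1).sum
decreasing_by
  have := List.sizeOf_lt_of_mem x.2
  simp only [PTree.node.sizeOf_spec, List.cons.sizeOf_spec] at this ⊢
  omega

def Good : PTree → Prop
  | node cs => cs.length ≠ 1 ∧ ∀ c ∈ cs.attach, Good c.1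
decreasing_by
  have := List.sizeOf_lt_of_mem c.2
  simp only [PTree.node.sizeOf_spec] at this ⊢
  omega

end PTree

def PT (n m : ℕ) : Type :=
  {t : PTree // t.Good ∧ t.leaves = n + 1 ∧ t.internal = m}

def PTn (n : ℕ) : Type := {t : PTree // t.Good ∧ t.leaves = n + 1}

/-! Motzkin paths -/

inductive MStep : Type
  | U | H | D
deriving DecidableEq

def MStep.dh : MStep → ℤ
  | .U => 1 | .H => 0 | .D => -1

def mHeight (p : List MStep) : ℤ := (p.map MStep.dh).sum

def IsMotzkin (k : ℕ) (p : List MStep) : Prop :=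
  p.length = k ∧ mHeight p = 0 ∧ ∀ q : List MStep, q <+: p → 0 ≤ mHeight q

def HFollowedByU (p : List MStep) : Prop :=
  ∀ q r : List MStep, p = q ++ MStep.H :: r → r = [] ∨ ∃ r' : List MStep, r = MStep.U :: r'

def MP (k : ℕ) : Type := {p : List MStep // IsMotzkin k p}
def RMP (k : ℕ) : Type := {p : List MStep // IsMotzkin k p ∧ HFollowedByU p}

/-- Motzkin steps with two possible colors on up and horizontal steps. -/
inductive CMStep : Type
  | U : Bool → CMStep
  | H : Bool → CMStep
  | D : CMStep
deriving DecidableEq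

def CMStep.forget : CMStep → MStep
  | .U _ => .U | .H _ => .H | .D => .D

/-- (h,u)-colored Motzkin paths of length n-1. -/
def huMP (n : ℕ) : Type := {p : List CMStep // IsMotzkin (n - 1) (p.map CMStep.forget)}

theorem dFollowedByH_nil : DFollowedByH [] := by
  intro q r h
  simp at h

theorem dFollowedByH_cons (s : SStep) (p : List SStep) :
    DFollowedByH (s :: p) ↔
      (s = .D → p = [] ∨ ∃ r, p = .H :: r) ∧ DFollowedByH p := by
  constructor
  · refine fun h => ⟨?_, fun q r hp => h (s :: q) r (by simp [hp])⟩
    rintro rfl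
    exact h [] p rfl
  · rintro ⟨h, hp⟩ (_ | ⟨t, q⟩) r e
    · simp only [List.nil_append, List.cons.injEq] at e
      obtain ⟨rfl, rfl⟩ := e
      exact h rfl
    · simp only [List.cons_append, List.cons.injEq] at e
      exact hp q r e.2

/-- The Dyck step underlying a Schröder step; diagonal steps are erased. -/
def SStep.toDyck : SStep → Option DyckStep
  | .H => some .U | .V => some .D | .D => none

/-- The sequence of Dyck steps obtained by erasing the diagonal steps. -/
def dyckSteps (p : List SStep) : List DyckStep := p.filterMap SStep.toDyck

theorem dyckSteps_nil : dyckSteps [] = [] := rfl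

theorem dyckSteps_cons_H (p : List SStep) : dyckSteps (.H :: p) = .U :: dyckSteps p := rfl

theorem dyckSteps_cons_V (p : List SStep) : dyckSteps (.V :: p) = .D :: dyckSteps p := rfl

theorem dyckSteps_cons_D (p : List SStep) : dyckSteps (.D :: p) = dyckSteps p := rfl

/-- Records, for each horizontal step and then for the end of the path, whether a diagonal step
immediately precedes it. Only meaningful for paths satisfying `DFollowedByH`. -/
def diagMarks : List SStep → List Bool
  | [] => [false]
  | .H :: p => false :: diagMarks p
  | .V :: p => diagMarks p
  | .D :: .H :: p => true :: diagMarks p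
  | .D :: _ => [true]

/-- Inserts diagonal steps in front of the marked up steps, and at the end if so marked. -/
def insertDiags : List DyckStep → List Bool → List SStep
  | [], b :: _ => if b then [.D] else []
  | .U :: w, b :: bs => (if b then [.D, .H] else [.H]) ++ insertDiags w bs
  | .D :: w, bs => .V :: insertDiags w bs
  | _, [] => []

theorem insertDiags_spec (w : List DyckStep) (bs : List Bool)
    (h : bs.length = w.count .U + 1) :
    dyckSteps (insertDiags w bs) = w ∧ diagMarks (insertDiags w bs) = bs ∧
      DFollowedByH (insertDiags w bs) := by
  induction w generalizing bs with
  | nil =>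
    obtain ⟨b, rfl⟩ := List.length_eq_one_iff.1 h
    cases b <;>
      simp [insertDiags, dyckSteps_nil, dyckSteps_cons_D, diagMarks, dFollowedByH_cons,
        dFollowedByH_nil]
  | cons s w ih =>
    cases s with
    | U =>
      obtain ⟨b, bs, rfl⟩ := List.exists_cons_of_length_eq_add_one h
      obtain ⟨h₁, h₂, h₃⟩ := ih bs (by simpa using h)
      cases b <;>
        simp_all [insertDiags, dyckSteps_cons_H, dyckSteps_cons_D, diagMarks, dFollowedByH_cons]
    | D =>
      obtain ⟨h₁, h₂, h₃⟩ := ih bs (by simpa using h)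
      simp_all [insertDiags, dyckSteps_cons_V, diagMarks, dFollowedByH_cons]

theorem insertDiags_dyckSteps_diagMarks (p : List SStep) (hp : DFollowedByH p) :
    insertDiags (dyckSteps p) (diagMarks p) = p ∧
      (diagMarks p).length = (dyckSteps p).count .U + 1 := by
  induction p using diagMarks.induct <;>
    simp_all [insertDiags, dyckSteps_nil, dyckSteps_cons_H, dyckSteps_cons_V, dyckSteps_cons_D,
      diagMarks, dFollowedByH_cons]

theorem pathX_eq (p : List SStep) : pathX p = (dyckSteps p).count .U + p.count .D := by
  induction p with
  | nil => rfl
  | cons s p ih =>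
    cases s <;> simp_all [pathX, SStep.dx, dyckSteps_cons_H, dyckSteps_cons_V, dyckSteps_cons_D] <;>
      omega

theorem pathY_eq (p : List SStep) : pathY p = (dyckSteps p).count .D + p.count .D := by
  induction p with
  | nil => rfl
  | cons s p ih =>
    cases s <;> simp_all [pathY, SStep.dy, dyckSteps_cons_H, dyckSteps_cons_V, dyckSteps_cons_D] <;>
      omega

theorem isSchroder_count_add_iff (p : List SStep) (m : ℕ) :
    IsSchroder (p.count .D + m) p ↔
      (dyckSteps p).count .U = m ∧ (dyckSteps p).count .D = m ∧
        ∀ i, ((dyckSteps p).take i).count .D ≤ ((dyckSteps p).take i).count .U := by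
  unfold IsSchroder
  simp only [pathX_eq, pathY_eq]
  refine and_congr (by omega) (and_congr (by omega) ⟨fun h i => ?_, fun h q hq => ?_⟩)
  · obtain ⟨q, hq, e⟩ := List.prefix_filterMap_iff.1 ⟨_, List.take_append_drop i (dyckSteps p)⟩
    have := h q hq
    rw [e]
    exact Nat.le_of_add_le_add_right this
  · have := h (dyckSteps q).length
    have e : dyckSteps q = (dyckSteps p).take (dyckSteps q).length :=
      List.prefix_iff_eq_take.1 (hq.filterMap SStep.toDyck)
    rw [← e] at this
    exact Nat.add_le_add_right this _

/-- The paths of `RP n m` for all `n` together. -/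
def RPTotal (m : ℕ) : Type :=
  {p : List SStep // IsSchroder (p.count .D + m) p ∧ DFollowedByH p}

/-- Erasing the diagonal steps while recording their positions. -/
def rpTotalEquiv (m : ℕ) :
    RPTotal m ≃ {w : DyckWord // w.semilength = m} × List.Vector Bool (m + 1) where
  toFun p :=
    have h := (isSchroder_count_add_iff p.1 m).1 p.2.1
    (⟨⟨dyckSteps p.1, h.1.trans h.2.1.symm, h.2.2⟩, h.1⟩,
      ⟨diagMarks p.1, by rw [(insertDiags_dyckSteps_diagMarks p.1 p.2.2).2, h.1]⟩)
  invFun x :=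
    have h := insertDiags_spec x.1.1.toList x.2.1 (by
      rw [x.2.2, show x.1.1.toList.count .U = m from x.1.2])
    ⟨insertDiags x.1.1.toList x.2.1, by
      rw [isSchroder_count_add_iff, h.1]
      exact ⟨⟨x.1.2, x.1.1.count_U_eq_count_D ▸ x.1.2, x.1.1.count_D_le_count_U⟩, h.2.2⟩⟩
  left_inv p := Subtype.ext (insertDiags_dyckSteps_diagMarks p.1 p.2.2).1
  right_inv x := by
    have h := insertDiags_spec x.1.1.toList x.2.1 (by
      rw [x.2.2, show x.1.1.toList.count .U = m from x.1.2])
    exact Prod.ext (Subtype.ext (DyckWord.ext h.1)) (Subtype.ext h.2.1)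

/-- `RP n m` is the part of `RPTotal m` of semilength `n`. -/
def rpEquivFiber (n m : ℕ) : RP n m ≃ {p : RPTotal m // p.1.count .D + m = n} where
  toFun p := ⟨⟨p.1, by rw [p.2.2.1]; exact p.2.1, p.2.2.2⟩, p.2.2.1⟩
  invFun p := ⟨p.1.1, (congrArg (IsSchroder · p.1.1) p.2).mp p.1.2.1, p.2, p.1.2.2⟩
  left_inv _ := rfl
  right_inv _ := rfl

theorem tsum_card_fiber {α β : Type*} [Finite α] (f : α → β) :
    ∑' b, Nat.card {a // f a = b} = Nat.card α := by
  classical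
  have := Fintype.ofFinite α
  rw [tsum_eq_sum (s := Finset.univ.image f), Nat.card_eq_fintype_card, ← Finset.card_univ,
    Finset.card_eq_sum_card_image f]
  · simp [Fintype.card_subtype]
  · intro b hb
    have : IsEmpty {a // f a = b} := ⟨fun a => hb (by simp [← a.2])⟩
    exact Nat.card_of_isEmpty

/-- Σ_{n≥1} |RP(n,m)| = 2^(m+1)·C(m). -/
theorem statement4 (m : ℕ) (hm : 1 ≤ m) :
    ∑' n : ℕ, Nat.card (RP (n + 1) m) = 2 ^ (m + 1) * catalan m := by
  have : Finite (RPTotal m) := .of_equiv _ (rpTotalEquiv m).symm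
  calc ∑' n : ℕ, Nat.card (RP (n + 1) m)
      = ∑' n : ℕ, Nat.card {p : RPTotal m // p.1.count .D + m - 1 = n} := by
        refine tsum_congr fun n => Nat.card_congr ((rpEquivFiber _ m).trans ?_)
        exact Equiv.subtypeEquivRight fun p => by omega
    _ = Nat.card (RPTotal m) := tsum_card_fiber _
    _ = 2 ^ (m + 1) * catalan m := by
        rw [Nat.card_congr (rpTotalEquiv m), Nat.card_prod, Nat.card_eq_fintype_card,
          Nat.card_eq_fintype_card, DyckWord.card_dyckWord_semilength_eq_catalan, card_vector,
          Fintype.card_bool, mul_comm]
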